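/- Let T be a rooted tree and k a positive integer. Then there exists a set S ⊆ V(T) of size at most k that is closed under taking descendants and satisfies H_k(T) = H_S(T). -/

import Mathlib

/-- A rooted tree on a node set `α`, given by its root and parent function
(the root is its own parent, and every node reaches the root by iterating `parent`). -/
structure RTree (α : Type*) where
  root : α
  parent : α → α
  parent_root : parent root = root
  reaches_root : ∀ v, ∃ k, parent^[k] v = root

namespace RTree

variable {α : Type*}

/-- `u` is a (weak) ancestor of `v` in `T`. -/
def ancestor (T : RTree α) (u v : α) : Prop := ∃ k, T.parent^[k] v = u

/-- `u` is a proper ancestor of `v` in `T`. -/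
def properAncestor (T : RTree α) (u v : α) : Prop := T.ancestor u v ∧ u ≠ v

/-- The node set of the subtree `T_v` of `T` rooted at `v`,
i.e. `v` together with all of its descendants. -/
def subtree (T : RTree α) (v : α) : Set α := {u | T.ancestor v u}

/-- A leaf of `T` is a node with no children. -/
def IsLeaf (T : RTree α) (v : α) : Prop := ∀ u, T.parent u = v → u = v

end RTree

/-- For `S ⊆ V(T)`, `H_S(T) = Σ_{v ∈ S} log₂(|S| / |V(T_v) ∩ S|)`. -/
noncomputable def entS {α : Type*} (T : RTree α) (S : Finset α) : ℝ :=
  ∑ v ∈ S, Real.logb 2 ((S.card : ℝ) / ((T.subtree v ∩ ↑S).ncard : ℝ))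

/-- For a positive integer `k`, `H_k(T) = max{ H_S(T) : S ⊆ V(T), |S| ≤ k }`. -/
noncomputable def entK {α : Type*} [Fintype α] (T : RTree α) (k : ℕ) : ℝ :=
  (Finset.filter (fun S => S.card ≤ k) (Finset.univ : Finset α).powerset).sup'
    ⟨∅, by simp⟩ (entS T)

/-- `S` is closed under taking descendants in `T`. -/
def DescClosed {α : Type*} (T : RTree α) (S : Finset α) : Prop :=
  ∀ v ∈ S, ∀ u ∈ T.subtree v, u ∈ S

namespace RTree

variable {α : Type*}

lemma ancestor_refl (T : RTree α) (v : α) : T.ancestor v v := ⟨0, rfl⟩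

lemma ancestor_of_ancestor_parent (T : RTree α) {x u : α} (h : T.ancestor x (T.parent u)) :
    T.ancestor x u := by
  obtain ⟨k, hk⟩ := h
  exact ⟨k + 1, by rwa [Function.iterate_succ_apply]⟩

lemma ancestor_parent_iff (T : RTree α) {x u : α} (hx : x ≠ u) :
    T.ancestor x (T.parent u) ↔ T.ancestor x u := by
  refine ⟨T.ancestor_of_ancestor_parent, ?_⟩
  rintro ⟨_ | k, hk⟩
  · exact absurd hk.symm hx
  · exact ⟨k, by rwa [Function.iterate_succ_apply] at hk⟩

lemma ancestor_trans (T : RTree α) {x y z : α} (hxy : T.ancestor x y) (hyz : T.ancestor y z) :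
    T.ancestor x z := by
  obtain ⟨k, rfl⟩ := hxy
  obtain ⟨l, rfl⟩ := hyz
  exact ⟨k + l, Function.iterate_add_apply _ _ _ _⟩

lemma not_ancestor_parent (T : RTree α) {u : α} (hu : T.parent u ≠ u) :
    ¬ T.ancestor u (T.parent u) := by
  rintro ⟨k, hk⟩
  have hper : Function.IsPeriodicPt T.parent (k + 1) u := by
    rwa [Function.IsPeriodicPt, Function.IsFixedPt, Function.iterate_succ_apply]
  obtain ⟨m, hm⟩ := T.reaches_root u
  have hroot : u = T.root := by
    have h := (hper.mul_const m).eq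
    rwa [Nat.succ_mul, Function.iterate_add_apply, hm,
      Function.iterate_fixed T.parent_root, eq_comm] at h
  exact hu (by rw [hroot, T.parent_root])

lemma subtree_ssubset_subtree_parent (T : RTree α) {u : α} (hu : T.parent u ≠ u) :
    T.subtree u ⊂ T.subtree (T.parent u) := by
  refine ⟨fun y hy => T.ancestor_trans ⟨1, rfl⟩ hy, fun h => ?_⟩
  exact T.not_ancestor_parent hu (h (T.ancestor_refl _))

/-- A set that is not closed under descendants omits a child of one of its nodes. -/
lemma exists_parent_mem_of_not_descClosed (T : RTree α) {S : Finset α} (h : ¬ DescClosed T S) :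
    ∃ u, u ∉ S ∧ T.parent u ∈ S := by
  contrapose! h
  rintro v hv u ⟨k, hk⟩
  induction k generalizing u with
  | zero => rwa [← show u = v from hk] at hv
  | succ k ih =>
    by_contra hu
    exact h u hu (ih _ (by rwa [Function.iterate_succ_apply] at hk))

end RTree

section Exchange

variable {α : Type*} [DecidableEq α] (T : RTree α) {S : Finset α} {u : α}

lemma card_insert_erase_parent (hu : u ∉ S) (hp : T.parent u ∈ S) :
    (insert u (S.erase (T.parent u))).card = S.card := by
  rw [Finset.card_insert_of_notMem (fun h => hu (Finset.mem_of_mem_erase h)),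
    Finset.card_erase_add_one hp]

lemma ncard_subtree_inter_insert_erase_parent (hu : u ∉ S) (hp : T.parent u ∈ S) {x : α}
    (hx : x ≠ u) :
    (T.subtree x ∩ ↑(insert u (S.erase (T.parent u)))).ncard = (T.subtree x ∩ ↑S).ncard := by
  have hiff := T.ancestor_parent_iff hx
  by_cases hxu : T.ancestor x u
  · rw [← Set.ncard_exchange (s := T.subtree x ∩ ↑S) (fun h => hu h.2) ⟨hiff.2 hxu, hp⟩]
    congr 1
    ext y
    by_cases hy : y = u
    · subst hy; simp [RTree.subtree, hxu]
    · simp [hy]; tauto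
  · congr 1
    ext y
    by_cases hy : y = u
    · subst hy; simp [RTree.subtree, hxu]
    · by_cases hy' : y = T.parent u
      · subst hy'; simp [RTree.subtree, hiff, hxu]
      · simp [hy, hy']

lemma ncard_subtree_inter_insert_erase_parent_le (hu : u ∉ S) (hp : T.parent u ∈ S) :
    (T.subtree u ∩ ↑(insert u (S.erase (T.parent u)))).ncard
      ≤ (T.subtree (T.parent u) ∩ ↑S).ncard := by
  have hne : T.parent u ≠ u := ne_of_mem_of_not_mem hp hu
  rw [← ncard_subtree_inter_insert_erase_parent T hu hp hne]
  exact Set.ncard_le_ncard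
    (Set.inter_subset_inter_left _ (T.subtree_ssubset_subtree_parent hne).1)
    ((Finset.finite_toSet _).inter_of_right _)

/-- Replacing a node of `S` by one of its children outside `S` does not decrease `H_S(T)`. -/
lemma entS_le_entS_insert_erase_parent (hu : u ∉ S) (hp : T.parent u ∈ S) :
    entS T S ≤ entS T (insert u (S.erase (T.parent u))) := by
  have hu' : u ∉ S.erase (T.parent u) := fun h => hu (Finset.mem_of_mem_erase h)
  unfold entS
  rw [card_insert_erase_parent T hu hp, Finset.sum_insert hu', ← Finset.add_sum_erase S _ hp]
  refine add_le_add ?_ (Finset.sum_le_sum fun x hx => ?_)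
  · have hS : (0 : ℝ) < S.card := by exact_mod_cast Finset.card_pos.2 ⟨_, hp⟩
    have hfin (x : α) (A : Finset α) : (T.subtree x ∩ ↑A).Finite :=
      (Finset.finite_toSet A).inter_of_right _
    have h1 : (0 : ℝ) < (T.subtree u ∩ ↑(insert u (S.erase (T.parent u)))).ncard := by
      exact_mod_cast (Set.ncard_pos (hfin _ _)).2
        ⟨u, T.ancestor_refl u, Finset.mem_coe.2 (Finset.mem_insert_self _ _)⟩
    have h2 : ((T.subtree u ∩ ↑(insert u (S.erase (T.parent u)))).ncard : ℝ)
        ≤ (T.subtree (T.parent u) ∩ ↑S).ncard := by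
      exact_mod_cast ncard_subtree_inter_insert_erase_parent_le T hu hp
    exact Real.logb_le_logb_of_le one_lt_two (div_pos hS (h1.trans_le h2))
      (div_le_div_of_nonneg_left hS.le h1 h2)
  · rw [ncard_subtree_inter_insert_erase_parent T hu hp (ne_of_mem_of_not_mem hx hu')]

end Exchange

/-- For every rooted tree `T` and positive integer `k`, there is a set `S` of at most `k`
nodes that is closed under taking descendants and attains `H_k(T)`. -/
theorem entK_attained_descClosed {α : Type*} [Fintype α] (T : RTree α) (k : ℕ) (hk : 0 < k) :
    ∃ S : Finset α, S.card ≤ k ∧ DescClosed T S ∧ entK T k = entS T S := by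
  classical
  have hle (A : Finset α) (hA : A.card ≤ k) : entS T A ≤ entK T k :=
    Finset.le_sup' (entS T) (by simpa using hA)
  let M : Finset (Finset α) := {A | A.card ≤ k ∧ entK T k = entS T A}
  have hM : M.Nonempty := by
    obtain ⟨A, hA, hAe⟩ := Finset.exists_mem_eq_sup' (s := Finset.filter
      (fun S => S.card ≤ k) (Finset.univ : Finset α).powerset) ⟨∅, by simp⟩ (entS T)
    exact ⟨A, by simpa [M] using ⟨(Finset.mem_filter.1 hA).2, hAe⟩⟩
  obtain ⟨S, hS, hmin⟩ := M.exists_min_image (fun A => ∑ v ∈ A, (T.subtree v).ncard) hM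
  obtain ⟨hcard, hent⟩ := (Finset.mem_filter.1 hS).2
  refine ⟨S, hcard, ?_, hent⟩
  by_contra hclosed
  obtain ⟨u, hu, hp⟩ := T.exists_parent_mem_of_not_descClosed hclosed
  have hcard' := (card_insert_erase_parent T hu hp).trans_le hcard
  have hmem : insert u (S.erase (T.parent u)) ∈ M := by
    refine Finset.mem_filter.2 ⟨Finset.mem_univ _, hcard', le_antisymm ?_ (hle _ hcard')⟩
    exact hent.trans_le (entS_le_entS_insert_erase_parent T hu hp)
  have hsum := hmin _ hmem
  have hlt := Set.ncard_lt_ncard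
    (T.subtree_ssubset_subtree_parent (ne_of_mem_of_not_mem hp hu)) (Set.toFinite _)
  rw [Finset.sum_insert fun h => hu (Finset.mem_of_mem_erase h),
    ← Finset.add_sum_erase S _ hp] at hsum
  omega
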